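/- arXiv:math-ph/0607063 — 2 statements merged into one kernel-verified Lean document; each statement's English description precedes it below -/
import Mathlib

section
/- Assume (E): Λ : ℤ^d → A is a colouring and (Q_j)_{j∈ℕ} a van Hove sequence such that for every box pattern P at the origin the frequency ν_P of P in Λ along (Q_j) exists. Let X be a Banach space and F : 𝓕 → X be Λ-invariant, almost-additive with boundary term b (with constant D such that b(Q) ≤ D|Q|), and bounded with constant C, and let F̄ := lim_{j→∞} F(Q_j)/|Q_j| (which exists). Then for all j, M ∈ ℕ: ‖F̄ − F(Q_j)/|Q_j|‖ ≤ 2·b(C_M)/|C_M| + C·Σ_{P∈𝓟_M} |♯_P(Λ∩Q_j)/|Q_j| − ν_P| + (C+D)·|∂^M Q_j|/|Q_j|. -/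
open Filter
noncomputable section

/-- `ℤ^d`. -/
abbrev Zd (d : ℕ) := Fin d → ℤ

namespace IDSZd

variable {d : ℕ} {A : Type*} {X : Type*}

/-- The ℓ∞ (maximum) distance on `ℤ^d`, as a natural number. -/
def dInf (x y : Zd d) : ℕ := Finset.univ.sup fun j => (x j - y j).natAbs

/-- The closed ℓ∞-ball of radius `S` around `q`, as a finset. -/
def ball (q : Zd d) (S : ℕ) : Finset (Zd d) :=
  Fintype.piFinset fun j => Finset.Icc (q j - S) (q j + S)

open Classical in
/-- The `S`-boundary `∂^S Q` of a finite set `Q ⊆ ℤ^d`:  points outside `Q` within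
distance `S` of `Q` together with points of `Q` within distance `S` of the complement. -/
def sBdry (S : ℕ) (Q : Finset (Zd d)) : Finset (Zd d) :=
  ((Q.biUnion fun q => ball q S).filter fun x => x ∉ Q) ∪
    (Q.filter fun x => ∃ y : Zd d, y ∉ Q ∧ dInf x y ≤ S)

/-- A van Hove sequence of (nonempty) finite subsets of `ℤ^d`. -/
def VanHove (Q : ℕ → Finset (Zd d)) : Prop :=
  (∀ j, (Q j).Nonempty) ∧
    ∀ S : ℕ, Tendsto (fun j => ((sBdry S (Q j)).card : ℝ) / ((Q j).card : ℝ)) atTop (nhds 0)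

/-- The translate `t + Q` of a finite set `Q ⊆ ℤ^d`. -/
def shift (t : Zd d) (Q : Finset (Zd d)) : Finset (Zd d) := Q.image (t + ·)

/-- The box `C_M = {0, …, M−1}^d`. -/
def cube (d M : ℕ) : Finset (Zd d) := Fintype.piFinset fun _ => Finset.Ico (0 : ℤ) (M : ℤ)

/-- A box `[a₁,b₁] × ⋯ × [a_d,b_d]` in `ℤ^d`. -/
def IsBox (Q : Finset (Zd d)) : Prop :=
  ∃ a b : Zd d, (∀ j, a j ≤ b j) ∧ Q = Fintype.piFinset fun j => Finset.Icc (a j) (b j)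

/-- A box at the origin, i.e. `[0,b₁] × ⋯ × [0,b_d]`. -/
def IsBoxAtOrigin (Q : Finset (Zd d)) : Prop :=
  ∃ b : Zd d, (∀ j, 0 ≤ b j) ∧ Q = Fintype.piFinset fun j => Finset.Icc 0 (b j)

open Classical in
/-- The number of occurrences `♯_P P'` of the pattern `P` with domain `B` (given by a
total function) in the pattern `P'` with domain `Q` given by the total function `L`. -/
def occ (B : Finset (Zd d)) (P : Zd d → A) (Q : Finset (Zd d)) (L : Zd d → A) : ℕ :=
  (Q.filter fun x => shift x B ⊆ Q ∧ ∀ y ∈ B, L (x + y) = P y).card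

/-- Extension of a pattern `P` with domain `B` to a total function on `ℤ^d`
(by a junk value taken from the colouring `Λ`). -/
def extPat (Λ : Zd d → A) (B : Finset (Zd d)) (P : ↥B → A) : Zd d → A :=
  fun y => if h : y ∈ B then P ⟨y, h⟩ else Λ 0

/-- `ν` is the frequency function of the colouring `Λ` along the sequence `Q`:
for every box pattern at the origin the frequency exists and is given by `ν`. -/
def Freqs (Λ : Zd d → A) (Q : ℕ → Finset (Zd d)) (ν : Finset (Zd d) → (Zd d → A) → ℝ) : Prop :=
  ∀ B : Finset (Zd d), IsBoxAtOrigin B → ∀ P : Zd d → A,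
    Tendsto (fun j => (occ B P (Q j) Λ : ℝ) / ((Q j).card : ℝ)) atTop (nhds (ν B P))

/-- A boundary term with constant `D`. -/
def IsBoundaryTerm (b : Finset (Zd d) → ℝ) (D : ℝ) : Prop :=
  (∀ Q, 0 ≤ b Q) ∧ (∀ t Q, b (shift t Q) = b Q) ∧
    (∀ Q : ℕ → Finset (Zd d), VanHove Q →
      Tendsto (fun j => b (Q j) / ((Q j).card : ℝ)) atTop (nhds 0)) ∧
    0 < D ∧ ∀ Q : Finset (Zd d), b Q ≤ D * Q.card

section NormedX
variable [NormedAddCommGroup X]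

/-- Almost additivity of `F` with boundary term `b`. -/
def AlmostAdditive (F : Finset (Zd d) → X) (b : Finset (Zd d) → ℝ) : Prop :=
  ∀ (m : ℕ) (Qs : Fin m → Finset (Zd d)), (∀ k l, k ≠ l → Disjoint (Qs k) (Qs l)) →
    ‖F (Finset.univ.biUnion Qs) - ∑ k, F (Qs k)‖ ≤ ∑ k, b (Qs k)

/-- `Λ`-invariance of `F`. -/
def Invariant (Λ : Zd d → A) (F : Finset (Zd d) → X) : Prop :=
  ∀ (t : Zd d) (Q : Finset (Zd d)), (∀ y ∈ Q, Λ (t + y) = Λ y) → F (shift t Q) = F Q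

/-- `Ft` is the map on box patterns at the origin (given by domain and total function,
depending only on the restriction of the function to the domain) induced by the
`Λ`-invariant map `F`. -/
def IsInducedMap (Λ : Zd d → A) (F : Finset (Zd d) → X)
    (Ft : Finset (Zd d) → (Zd d → A) → X) : Prop :=
  (∀ (B : Finset (Zd d)) (P P' : Zd d → A), (∀ y ∈ B, P y = P' y) → Ft B P = Ft B P') ∧
    ∀ (t : Zd d) (Q : Finset (Zd d)), IsBoxAtOrigin Q →
      F (shift t Q) = Ft Q fun y => Λ (t + y)

/-- Boundedness of `F` with constant `C`. -/
def Bounded (F : Finset (Zd d) → X) (C : ℝ) : Prop := ∀ Q : Finset (Zd d), ‖F Q‖ ≤ C * Q.card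

/-- The pattern average `Σ_{P ∈ 𝓟_M} ν_P F̃(P) / |C_M|`. -/
def patAvg [NormedSpace ℝ X] [Fintype A] (Λ : Zd d → A)
    (ν : Finset (Zd d) → (Zd d → A) → ℝ) (Ft : Finset (Zd d) → (Zd d → A) → X) (M : ℕ) : X :=
  (((cube d M).card : ℝ))⁻¹ • ∑ P : ↥(cube d M) → A,
    ν (cube d M) (extPat Λ (cube d M) P) • Ft (cube d M) (extPat Λ (cube d M) P)

end NormedX

/-- The set of shifts `a` with `C_M(a) ∩ Q ≠ ∅`. -/
def coverShifts (Q : Finset (Zd d)) (M : ℕ) : Finset (Zd d) :=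
  Q.biUnion fun q => Fintype.piFinset fun j => Finset.Ioc (q j - M) (q j)

/-- The set `D_{Q,x,M}` of lattice shifts `a ∈ x + (Mℤ)^d` whose box `C_M(a)` meets `Q`
but is not contained in `Q`. -/
def latticeD (Q : Finset (Zd d)) (x : Zd d) (M : ℕ) : Finset (Zd d) :=
  (coverShifts Q M).filter fun a => (∀ j, (M : ℤ) ∣ (a j - x j)) ∧ ¬ shift a (cube d M) ⊆ Q

/-- The set `I_{Q,x,M}` of lattice shifts `a ∈ x + (Mℤ)^d` with `C_M(a) ⊆ Q` (for `M ≥ 1`). -/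
def latticeI (Q : Finset (Zd d)) (x : Zd d) (M : ℕ) : Finset (Zd d) :=
  (coverShifts Q M).filter fun a => (∀ j, (M : ℤ) ∣ (a j - x j)) ∧ shift a (cube d M) ⊆ Q


lemma mem_shift_cube {a q : Zd d} {M : ℕ} :
    q ∈ shift a (cube d M) ↔ ∀ j, a j ≤ q j ∧ q j < a j + M := by
  simp only [shift, cube, Finset.mem_image, Fintype.mem_piFinset, Finset.mem_Ico]
  constructor
  · rintro ⟨y, hy, rfl⟩ j
    have := hy j
    simp only [Pi.add_apply]
    omega
  · intro h
    refine ⟨q - a, fun j => ?_, by simp⟩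
    have := h j
    simp only [Pi.sub_apply]
    omega

lemma card_shift (t : Zd d) (Q : Finset (Zd d)) : (shift t Q).card = Q.card :=
  Finset.card_image_of_injective _ (add_right_injective t)

lemma shift_shift (s t : Zd d) (Q : Finset (Zd d)) : shift s (shift t Q) = shift (s + t) Q := by
  simp only [shift, Finset.image_image]
  congr 1
  funext y
  simp [add_assoc]

/-- residue of a point modulo `M`. -/
def resid (M : ℕ) (a : Zd d) : Zd d := fun j => a j % (M : ℤ)

/-- base point of the cube of the lattice `x + Mℤ^d` containing `q`. -/
def base (M : ℕ) (x q : Zd d) : Zd d := fun j => q j - (q j - x j) % (M : ℤ)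

lemma resid_mem {M : ℕ} (hM : 1 ≤ M) (a : Zd d) : resid M a ∈ cube d M := by
  simp only [resid, cube, Fintype.mem_piFinset, Finset.mem_Ico]
  intro j
  exact ⟨Int.emod_nonneg _ (by omega), Int.emod_lt_of_pos _ (by omega)⟩

lemma base_eq_iff {M : ℕ} (hM : 1 ≤ M) {x q a : Zd d} (hx : x ∈ cube d M) :
    base M x q = a ↔ resid M a = x ∧ q ∈ shift a (cube d M) := by
  rw [mem_shift_cube]
  simp only [cube, Fintype.mem_piFinset, Finset.mem_Ico] at hx
  have hM0 : (0 : ℤ) < M := by omega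
  simp only [funext_iff, base, resid]
  rw [← forall_and]
  refine forall_congr' fun j => ?_
  have h1 := hx j
  constructor
  · intro h
    have h2 := Int.emod_nonneg (q j - x j) hM0.ne'
    have h3 := Int.emod_lt_of_pos (q j - x j) hM0
    refine ⟨?_, by omega, by omega⟩
    have h4 := Int.mul_ediv_add_emod (q j - x j) M
    have h5 : a j = x j + M * ((q j - x j) / M) := by omega
    rw [h5, Int.add_mul_emod_self_left]
    exact Int.emod_eq_of_lt h1.1 h1.2
  · rintro ⟨h, h2, h3⟩
    have h4 := Int.mul_ediv_add_emod (a j) M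
    have h5 : q j - x j = (q j - a j) + M * (a j / M) := by omega
    rw [h5, Int.add_mul_emod_self_left, Int.emod_eq_of_lt (by omega) (by omega)]
    omega

lemma almostAdditive_finset [NormedAddCommGroup X] {F : Finset (Zd d) → X}
    {b : Finset (Zd d) → ℝ} (hAA : AlmostAdditive F b) {ι : Type*} (S : Finset ι)
    (g : ι → Finset (Zd d)) (hg : ∀ k ∈ S, ∀ l ∈ S, k ≠ l → Disjoint (g k) (g l)) :
    ‖F (S.biUnion g) - ∑ k ∈ S, F (g k)‖ ≤ ∑ k ∈ S, b (g k) := by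
  classical
  have key := hAA S.card (fun i => g (S.equivFin.symm i)) (by
    intro k l hkl
    refine hg _ (S.equivFin.symm k).2 _ (S.equivFin.symm l).2 ?_
    intro h
    exact hkl (S.equivFin.symm.injective (Subtype.ext h)))
  have hs : ∀ {Y : Type _} [AddCommMonoid Y] (f : Finset (Zd d) → Y),
      ∑ i : Fin S.card, f (g (S.equivFin.symm i)) = ∑ k ∈ S, f (g k) := by
    intro Y _ f
    rw [← Finset.sum_coe_sort S (fun k => f (g k))]
    exact Equiv.sum_comp S.equivFin.symm (fun k : S => f (g k))
  have hb : ∑ i : Fin S.card, b (g (S.equivFin.symm i)) = ∑ k ∈ S, b (g k) := by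
    rw [← Finset.sum_coe_sort S (fun k => b (g k))]
    exact Equiv.sum_comp S.equivFin.symm (fun k : S => b (g k))
  have hU : (Finset.univ.biUnion fun i : Fin S.card => g (S.equivFin.symm i)) = S.biUnion g := by
    ext z
    simp only [Finset.mem_biUnion, Finset.mem_univ, true_and]
    constructor
    · rintro ⟨i, hi⟩
      exact ⟨_, (S.equivFin.symm i).2, hi⟩
    · rintro ⟨k, hk, hz⟩
      exact ⟨S.equivFin ⟨k, hk⟩, by simpa using hz⟩
  rw [hs F, hb, hU] at key
  exact key

open Classical in
/-- the shifts `a ∈ Q` with `C_M(a) ⊆ Q`. -/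
def fullS (M : ℕ) (Q : Finset (Zd d)) : Finset (Zd d) :=
  Q.filter fun a => shift a (cube d M) ⊆ Q

open Classical in
lemma one_offset [NormedAddCommGroup X] {F : Finset (Zd d) → X}
    {b : Finset (Zd d) → ℝ} {C D : ℝ} (hAA : AlmostAdditive F b) (hb : IsBoundaryTerm b D)
    (hC : 0 < C) (hBd : Bounded F C) {M : ℕ} (hM : 1 ≤ M) (Q : Finset (Zd d)) {x : Zd d}
    (hx : x ∈ cube d M) :
    ‖F Q - ∑ a ∈ (fullS M Q).filter (fun a => resid M a = x), F (shift a (cube d M))‖ ≤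
      ∑ a ∈ (fullS M Q).filter (fun a => resid M a = x), b (cube d M)
        + (C + D) * (sBdry M Q).card := by
  obtain ⟨hb0, hbt, -, hD, hbD⟩ := hb
  set S := Q.image (base M x) with hS
  set g : Zd d → Finset (Zd d) := fun a => Q.filter fun q => base M x q = a with hg
  have hdisj : ∀ k l, k ≠ l → Disjoint (g k) (g l) := by
    intro k l hkl
    rw [Finset.disjoint_left]
    intro z hz hz'
    simp only [hg, Finset.mem_filter] at hz hz'
    exact hkl (hz.2.symm.trans hz'.2)
  have hUn : S.biUnion g = Q := by
    ext z
    simp only [hS, hg, Finset.mem_biUnion, Finset.mem_image, Finset.mem_filter]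
    constructor
    · rintro ⟨_, _, h, _⟩; exact h
    · intro h; exact ⟨_, ⟨z, h, rfl⟩, h, rfl⟩
  have hAA' := almostAdditive_finset hAA S g (fun k _ l _ h => hdisj k l h)
  rw [hUn] at hAA'
  have hself : ∀ a : Zd d, a ∈ shift a (cube d M) := by
    intro a
    rw [mem_shift_cube]
    intro j
    omega
  have hfull : S.filter (fun a => shift a (cube d M) ⊆ Q) =
      (fullS M Q).filter (fun a => resid M a = x) := by
    ext a
    simp only [hS, fullS, Finset.mem_filter, Finset.mem_image]
    constructor
    · rintro ⟨⟨q, hq, h⟩, h2⟩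
      exact ⟨⟨h2 (hself a), h2⟩, ((base_eq_iff hM hx).1 h).1⟩
    · rintro ⟨⟨h1, h2⟩, h3⟩
      exact ⟨⟨a, h1, (base_eq_iff hM hx).2 ⟨h3, hself a⟩⟩, h2⟩
  have hgfull : ∀ a ∈ S.filter (fun a => shift a (cube d M) ⊆ Q), g a = shift a (cube d M) := by
    intro a ha
    have ha' := ha
    rw [hfull, Finset.mem_filter] at ha'
    rw [Finset.mem_filter] at ha
    ext q
    simp only [hg, Finset.mem_filter]
    rw [base_eq_iff hM hx]
    constructor
    · rintro ⟨_, _, h⟩; exact h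
    · intro h; exact ⟨ha.2 h, ha'.2, h⟩
  have hcard : ∑ a ∈ S.filter (fun a => ¬ shift a (cube d M) ⊆ Q), ((g a).card : ℝ)
      ≤ (sBdry M Q).card := by
    rw [← Nat.cast_sum, ← Finset.card_biUnion (fun k _ l _ h => hdisj k l h)]
    norm_cast
    refine Finset.card_le_card fun z hz => ?_
    simp only [Finset.mem_biUnion, Finset.mem_filter, hg] at hz
    obtain ⟨a, ⟨_, hna⟩, hzQ, hz⟩ := hz
    rw [base_eq_iff hM hx] at hz
    obtain ⟨y, hy, hyQ⟩ := Finset.not_subset.1 hna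
    refine Finset.mem_union_right _ (Finset.mem_filter.2 ⟨hzQ, y, hyQ, ?_⟩)
    refine Finset.sup_le fun j _ => ?_
    have h1 := mem_shift_cube.1 hz.2 j
    have h2 := mem_shift_cube.1 hy j
    omega
  rw [← Finset.sum_filter_add_sum_filter_not S (fun a => shift a (cube d M) ⊆ Q)
      (fun k => F (g k)),
    ← Finset.sum_filter_add_sum_filter_not S (fun a => shift a (cube d M) ⊆ Q)
      (fun k => b (g k)),
    Finset.sum_congr rfl (fun a ha => by rw [hgfull a ha]),
    Finset.sum_congr (f := fun k => b (g k)) (g := fun _ => b (cube d M)) rfl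
      (fun a ha => by rw [hgfull a ha, hbt]), hfull] at hAA'
  set T := (fullS M Q).filter (fun a => resid M a = x)
  set N := S.filter (fun a => ¬ shift a (cube d M) ⊆ Q)
  have h1 : ‖∑ a ∈ N, F (g a)‖ ≤ C * (sBdry M Q).card := by
    calc ‖∑ a ∈ N, F (g a)‖ ≤ ∑ a ∈ N, C * (g a).card := norm_sum_le_of_le _ (fun a _ => hBd _)
      _ = C * ∑ a ∈ N, ((g a).card : ℝ) := by rw [Finset.mul_sum]
      _ ≤ _ := by gcongr
  have h2 : ∑ a ∈ N, b (g a) ≤ D * (sBdry M Q).card := by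
    calc ∑ a ∈ N, b (g a) ≤ ∑ a ∈ N, D * (g a).card := Finset.sum_le_sum (fun a _ => hbD _)
      _ = D * ∑ a ∈ N, ((g a).card : ℝ) := by rw [Finset.mul_sum]
      _ ≤ _ := by gcongr
  have h3 : F Q - ∑ a ∈ T, F (shift a (cube d M)) =
      (F Q - (∑ a ∈ T, F (shift a (cube d M)) + ∑ a ∈ N, F (g a))) + ∑ a ∈ N, F (g a) := by
    abel
  rw [h3]
  refine (norm_add_le _ _).trans ?_
  linarith

lemma averaged [NormedAddCommGroup X] [NormedSpace ℝ X] {F : Finset (Zd d) → X}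
    {b : Finset (Zd d) → ℝ} {C D : ℝ} (hAA : AlmostAdditive F b) (hb : IsBoundaryTerm b D)
    (hC : 0 < C) (hBd : Bounded F C) {M : ℕ} (hM : 1 ≤ M) (Q : Finset (Zd d)) :
    ‖((cube d M).card : ℝ) • F Q - ∑ a ∈ fullS M Q, F (shift a (cube d M))‖ ≤
      Q.card * b (cube d M) + (cube d M).card * ((C + D) * (sBdry M Q).card) := by
  classical
  rw [← Finset.sum_fiberwise_of_maps_to (s := fullS M Q) (t := cube d M) (g := resid M)
    (fun a _ => resid_mem hM a) (fun a => F (shift a (cube d M)))]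
  have h1 : ((cube d M).card : ℝ) • F Q = ∑ x ∈ cube d M, F Q := by
    rw [Finset.sum_const, Nat.cast_smul_eq_nsmul]
  rw [h1, ← Finset.sum_sub_distrib]
  refine (norm_sum_le_of_le _ (fun x hx => one_offset hAA hb hC hBd hM Q hx)).trans ?_
  rw [Finset.sum_add_distrib, Finset.sum_fiberwise_of_maps_to (fun a _ => resid_mem hM a),
    Finset.sum_const, Finset.sum_const, nsmul_eq_mul, nsmul_eq_mul]
  have h0 := hb.1 (cube d M)
  have : (fullS M Q).card ≤ Q.card := Finset.card_filter_le _ _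
  gcongr

open Classical in
/-- The value of `F` on a pattern (zero if the pattern does not occur). -/
def patF [NormedAddCommGroup X] (Λ : Zd d → A) (F : Finset (Zd d) → X) (M : ℕ)
    (P : ↥(cube d M) → A) : X :=
  if h : ∃ t : Zd d, ∀ y ∈ cube d M, Λ (t + y) = extPat Λ (cube d M) P y then
    F (shift h.choose (cube d M)) else 0

lemma norm_patF [NormedAddCommGroup X] {Λ : Zd d → A} {F : Finset (Zd d) → X} {C : ℝ}
    (hC : 0 < C) (hBd : Bounded F C) (M : ℕ) (P : ↥(cube d M) → A) :
    ‖patF Λ F M P‖ ≤ C * (cube d M).card := by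
  unfold patF
  split_ifs with h
  · have := hBd (shift h.choose (cube d M))
    rwa [card_shift] at this
  · rw [norm_zero]; positivity

lemma patF_eq [NormedAddCommGroup X] {Λ : Zd d → A} {F : Finset (Zd d) → X}
    (hInv : Invariant Λ F) {M : ℕ} {P : ↥(cube d M) → A} {t : Zd d}
    (ht : ∀ y ∈ cube d M, Λ (t + y) = extPat Λ (cube d M) P y) :
    F (shift t (cube d M)) = patF Λ F M P := by
  have h : ∃ t : Zd d, ∀ y ∈ cube d M, Λ (t + y) = extPat Λ (cube d M) P y := ⟨t, ht⟩
  unfold patF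
  rw [dif_pos h]
  have hs := h.choose_spec
  set s := h.choose
  have := hInv (t - s) (shift s (cube d M)) (by
    intro y hy
    obtain ⟨z, hz, rfl⟩ := Finset.mem_image.1 hy
    rw [hs z hz, ← ht z hz]
    congr 1
    abel)
  rwa [shift_shift, sub_add_cancel] at this

lemma sum_patF [NormedAddCommGroup X] [NormedSpace ℝ X] [Fintype A] {Λ : Zd d → A}
    {F : Finset (Zd d) → X} (hInv : Invariant Λ F) (M : ℕ) (Q : Finset (Zd d)) :
    ∑ a ∈ fullS M Q, F (shift a (cube d M)) =
      ∑ P : ↥(cube d M) → A,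
        (occ (cube d M) (extPat Λ (cube d M) P) Q Λ : ℝ) • patF Λ F M P := by
  classical
  rw [← Finset.sum_fiberwise (fullS M Q)
    (fun a => (fun y : ↥(cube d M) => Λ (a + y))) (fun a => F (shift a (cube d M)))]
  refine Finset.sum_congr rfl fun P _ => ?_
  have hiff : ∀ a : Zd d, (fun y : ↥(cube d M) => Λ (a + y)) = P ↔
      ∀ y ∈ cube d M, Λ (a + y) = extPat Λ (cube d M) P y := by
    intro a
    constructor
    · rintro rfl y hy
      simp [extPat, hy]
    · intro h
      funext y
      have := h y y.2
      simpa [extPat] using this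
  rw [Finset.sum_congr rfl (g := fun _ => patF Λ F M P)
    (fun a ha => patF_eq hInv ((hiff a).1 (Finset.mem_filter.1 ha).2)),
    Finset.sum_const, Nat.cast_smul_eq_nsmul]
  congr 1
  unfold occ fullS
  rw [Finset.filter_filter]
  congr 1
  ext a
  simp only [Finset.mem_filter, hiff]

lemma approx [NormedAddCommGroup X] [NormedSpace ℝ X] [Fintype A] {Λ : Zd d → A}
    {F : Finset (Zd d) → X} (hInv : Invariant Λ F)
    {b : Finset (Zd d) → ℝ} {C D : ℝ} (hAA : AlmostAdditive F b) (hb : IsBoundaryTerm b D)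
    (hC : 0 < C) (hBd : Bounded F C) {M : ℕ} (hM : 1 ≤ M) (Q : Finset (Zd d))
    (hQ : Q.Nonempty) :
    ‖(Q.card : ℝ)⁻¹ • F Q - ((cube d M).card : ℝ)⁻¹ • ∑ P : ↥(cube d M) → A,
        ((occ (cube d M) (extPat Λ (cube d M) P) Q Λ : ℝ) / (Q.card : ℝ)) • patF Λ F M P‖ ≤
      b (cube d M) / ((cube d M).card : ℝ)
        + (C + D) * (((sBdry M Q).card : ℝ) / (Q.card : ℝ)) := by
  have hq : (0 : ℝ) < Q.card := by exact_mod_cast hQ.card_pos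
  have hc : (0 : ℝ) < (cube d M).card := by
    exact_mod_cast Finset.card_pos.2 ⟨_, resid_mem hM 0⟩
  have h := averaged hAA hb hC hBd hM Q
  rw [sum_patF hInv] at h
  have e : (Q.card : ℝ)⁻¹ • F Q - ((cube d M).card : ℝ)⁻¹ • ∑ P : ↥(cube d M) → A,
        ((occ (cube d M) (extPat Λ (cube d M) P) Q Λ : ℝ) / (Q.card : ℝ)) • patF Λ F M P =
      ((Q.card : ℝ)⁻¹ * ((cube d M).card : ℝ)⁻¹) • (((cube d M).card : ℝ) • F Q -
        ∑ P : ↥(cube d M) → A,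
        (occ (cube d M) (extPat Λ (cube d M) P) Q Λ : ℝ) • patF Λ F M P) := by
    rw [smul_sub, smul_smul, mul_assoc, inv_mul_cancel₀ hc.ne', mul_one, mul_comm, mul_smul,
      Finset.smul_sum (r := (Q.card : ℝ)⁻¹)]
    simp only [smul_smul, div_eq_inv_mul]
  rw [e, norm_smul, Real.norm_of_nonneg (by positivity)]
  refine (mul_le_mul_of_nonneg_left h (by positivity)).trans (le_of_eq ?_)
  field_simp

/-- **Corollary (a priori bound on the speed of convergence):** under assumption (E), with
`F̄ = lim_j F(Q_j)/|Q_j|`, for all `j, M`: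
`‖F̄ − F(Q_j)/|Q_j|‖ ≤ 2 b(C_M)/|C_M| + C Σ_{P∈𝓟_M} |♯_P(Λ∩Q_j)/|Q_j| − ν_P|
   + (C+D)|∂^M Q_j|/|Q_j|`. -/
theorem ergodic_speed_of_convergence {X : Type*} [NormedAddCommGroup X] [NormedSpace ℝ X]
    [CompleteSpace X] [Fintype A]
    (hd : 1 ≤ d) (Λ : Zd d → A) (Qs : ℕ → Finset (Zd d)) (hvH : VanHove Qs)
    (ν : Finset (Zd d) → (Zd d → A) → ℝ) (hν : Freqs Λ Qs ν)
    (F : Finset (Zd d) → X) (b : Finset (Zd d) → ℝ) (D : ℝ) (hb : IsBoundaryTerm b D)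
    (hInv : Invariant Λ F) (hAA : AlmostAdditive F b)
    (C : ℝ) (hCpos : 0 < C) (hBd : Bounded F C)
    (Fbar : X)
    (hFbar : Filter.Tendsto (fun j => (((Qs j).card : ℝ))⁻¹ • F (Qs j))
      Filter.atTop (nhds Fbar)) :
    ∀ (j M : ℕ), 1 ≤ M →
      ‖Fbar - (((Qs j).card : ℝ))⁻¹ • F (Qs j)‖ ≤
        2 * (b (cube d M) / ((cube d M).card : ℝ))
        + C * ∑ P : ↥(cube d M) → A,
            |(occ (cube d M) (extPat Λ (cube d M) P) (Qs j) Λ : ℝ) / ((Qs j).card : ℝ)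
              - ν (cube d M) (extPat Λ (cube d M) P)|
        + (C + D) * (((sBdry M (Qs j)).card : ℝ) / ((Qs j).card : ℝ)) := by
  intro j M hM
  have hc : (0 : ℝ) < (cube d M).card := by
    exact_mod_cast Finset.card_pos.2 ⟨_, resid_mem hM 0⟩
  have hbox : IsBoxAtOrigin (cube d M) := by
    refine ⟨fun _ => (M : ℤ) - 1, fun _ => by show (0 : ℤ) ≤ (M : ℤ) - 1; omega, ?_⟩
    unfold cube
    congr 1
    funext _
    ext z
    simp only [Finset.mem_Ico, Finset.mem_Icc]
    omega
  set G : X := ((cube d M).card : ℝ)⁻¹ • ∑ P : ↥(cube d M) → A,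
    ν (cube d M) (extPat Λ (cube d M) P) • patF Λ F M P with hG
  have hlim : ‖Fbar - G‖ ≤ b (cube d M) / ((cube d M).card : ℝ) := by
    have h1 := (hFbar.sub ((tendsto_finsetSum (Finset.univ : Finset (↥(cube d M) → A))
      (fun P _ => (hν _ hbox (extPat Λ (cube d M) P)).smul_const (patF Λ F M P))).const_smul
        ((cube d M).card : ℝ)⁻¹)).norm
    have h2 := ((hvH.2 M).const_mul (C + D)).const_add (b (cube d M) / ((cube d M).card : ℝ))
    rw [mul_zero, add_zero] at h2
    exact le_of_tendsto_of_tendsto' h1 h2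
      (fun i => approx hInv hAA hb hCpos hBd hM (Qs i) (hvH.1 i))
  have hj := approx hInv hAA hb hCpos hBd hM (Qs j) (hvH.1 j)
  set H : X := ((cube d M).card : ℝ)⁻¹ • ∑ P : ↥(cube d M) → A,
    ((occ (cube d M) (extPat Λ (cube d M) P) (Qs j) Λ : ℝ) / ((Qs j).card : ℝ)) • patF Λ F M P
    with hH
  have hGH : ‖H - G‖ ≤ C * ∑ P : ↥(cube d M) → A,
            |(occ (cube d M) (extPat Λ (cube d M) P) (Qs j) Λ : ℝ) / ((Qs j).card : ℝ)
              - ν (cube d M) (extPat Λ (cube d M) P)| := by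
    rw [hH, hG, ← smul_sub, ← Finset.sum_sub_distrib, norm_smul,
      Real.norm_of_nonneg (by positivity)]
    rw [inv_mul_le_iff₀ hc, Finset.mul_sum, Finset.mul_sum]
    refine norm_sum_le_of_le _ fun P _ => ?_
    rw [← sub_smul, norm_smul, Real.norm_eq_abs]
    refine (mul_le_mul_of_nonneg_left (norm_patF hCpos hBd M P) (abs_nonneg _)).trans
      (le_of_eq ?_)
    ring
  have e : Fbar - (((Qs j).card : ℝ))⁻¹ • F (Qs j) =
      (Fbar - G) - (H - G) - ((((Qs j).card : ℝ))⁻¹ • F (Qs j) - H) := by abel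
  rw [e]
  have t1 := norm_sub_le ((Fbar - G) - (H - G)) ((((Qs j).card : ℝ))⁻¹ • F (Qs j) - H)
  have t2 := norm_sub_le (Fbar - G) (H - G)
  linarith


end IDSZd
end
end

section
/- Assume (E): Λ : ℤ^d → A is a colouring and (Q_j)_{j∈ℕ} a van Hove sequence such that for every box pattern P at the origin the frequency ν_P of P in Λ along (Q_j) exists. Let X be a Banach space and F : 𝓕 → X be Λ-invariant (with induced map F̃ on box patterns at the origin), almost-additive with boundary term b, and bounded with constant C, and let F̄ := lim_{j→∞} F(Q_j)/|Q_j| (which exists). Then for all M ∈ ℕ: ‖F̄ − Σ_{P∈𝓟_M} ν_P F̃(P)/|C_M|‖ ≤ b(C_M)/|C_M|. -/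
open Filter
noncomputable section

namespace IDSZd

variable {d : ℕ} {A : Type*} {X : Type*}

theorem aa_finset {X : Type*} [NormedAddCommGroup X] {F : Finset (Zd d) → X}
    {b : Finset (Zd d) → ℝ} (hAA : AlmostAdditive F b) {ι : Type*} (s : Finset ι)
    (f : ι → Finset (Zd d)) (hf : ∀ i ∈ s, ∀ k ∈ s, i ≠ k → Disjoint (f i) (f k)) :
    ‖F (s.biUnion f) - ∑ i ∈ s, F (f i)‖ ≤ ∑ i ∈ s, b (f i) := by
  classical
  let e := s.equivFin
  have h := hAA s.card (fun k => f (e.symm k)) (by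
    intro k l hkl
    refine hf _ (e.symm k).2 _ (e.symm l).2 ?_
    intro h
    exact hkl (e.symm.injective (Subtype.ext h)))
  have h1 : (Finset.univ.biUnion fun k => f (e.symm k)) = s.biUnion f := by
    ext z
    simp only [Finset.mem_biUnion, Finset.mem_univ, true_and]
    constructor
    · rintro ⟨k, hk⟩
      exact ⟨_, (e.symm k).2, hk⟩
    · rintro ⟨i, hi, hz⟩
      exact ⟨e ⟨i, hi⟩, by simpa using hz⟩
  have h2 : ∑ k, F (f (e.symm k)) = ∑ i ∈ s, F (f i) := by
    rw [← Finset.sum_coe_sort s (fun i => F (f i))]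
    exact Equiv.sum_comp e.symm (fun i : s => F (f i))
  have h3 : ∑ k, b (f (e.symm k)) = ∑ i ∈ s, b (f i) := by
    rw [← Finset.sum_coe_sort s (fun i => b (f i))]
    exact Equiv.sum_comp e.symm (fun i : s => b (f i))
  rw [h1, h2, h3] at h
  exact h

theorem mem_cube' {M : ℕ} {y : Zd d} : y ∈ cube d M ↔ ∀ j, 0 ≤ y j ∧ y j < M := by
  simp [cube, Fintype.mem_piFinset]

theorem mem_shift' {t z : Zd d} {Q : Finset (Zd d)} : z ∈ shift t Q ↔ z - t ∈ Q := by
  simp only [shift, Finset.mem_image]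
  constructor
  · rintro ⟨y, hy, rfl⟩
    simpa using hy
  · intro h
    exact ⟨_, h, by simp⟩

/-- Shifts `a ∈ Q` whose cube lies in `Q`. -/
def goodS (Q : Finset (Zd d)) (M : ℕ) : Finset (Zd d) :=
  Q.filter fun a => shift a (cube d M) ⊆ Q

/-- Residue. -/
def res (M : ℕ) (a : Zd d) : Zd d := fun j => a j % (M : ℤ)

theorem res_mem {M : ℕ} (hM : 1 ≤ M) (a : Zd d) : res M a ∈ cube d M := by
  rw [mem_cube']
  intro j
  have : (0 : ℤ) < M := by exact_mod_cast hM
  exact ⟨Int.emod_nonneg _ this.ne', Int.emod_lt_of_pos _ this⟩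

theorem shift_disj {M : ℕ} (a c : Zd d) (h : res M a = res M c) (hne : a ≠ c) :
    Disjoint (shift a (cube d M)) (shift c (cube d M)) := by
  rw [Finset.disjoint_left]
  intro z hz hz'
  rw [mem_shift', mem_cube'] at hz hz'
  apply hne
  funext j
  have h1 := hz j
  have h2 := hz' j
  have h3 : a j % (M : ℤ) = c j % (M : ℤ) := congrFun h j
  simp only [Pi.sub_apply] at h1 h2
  have h4 : (M : ℤ) ∣ a j - c j := Int.ModEq.dvd (Int.ModEq.symm h3)
  have h5 : a j - c j = 0 := by
    apply Int.eq_zero_of_abs_lt_dvd h4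
    rw [abs_lt]
    constructor <;> linarith
  linarith

theorem cover {M : ℕ} (hM : 1 ≤ M) (Q : Finset (Zd d)) (x : Zd d) (hx : x ∈ cube d M)
    (q : Zd d) (hq : q ∈ Q) (hqb : q ∉ sBdry M Q) :
    ∃ a ∈ goodS Q M, res M a = x ∧ q ∈ shift a (cube d M) := by
  have hM0 : (0 : ℤ) < M := by exact_mod_cast hM
  rw [mem_cube'] at hx
  let a : Zd d := fun j => q j - (q j - x j) % (M : ℤ)
  have hsub : shift a (cube d M) ⊆ Q := by
    intro z hz
    by_contra hzQ
    apply hqb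
    rw [mem_shift', mem_cube'] at hz
    simp only [sBdry, Finset.mem_union, Finset.mem_filter]
    right
    refine ⟨hq, z, hzQ, ?_⟩
    unfold dInf
    apply Finset.sup_le
    intro j _
    have h1 := hz j
    simp only [Pi.sub_apply, a] at h1
    have h2 := Int.emod_nonneg (q j - x j) hM0.ne'
    have h3 := Int.emod_lt_of_pos (q j - x j) hM0
    omega
  refine ⟨a, ?_, ?_, ?_⟩
  · rw [goodS, Finset.mem_filter]
    refine ⟨hsub ?_, hsub⟩
    rw [mem_shift', mem_cube']
    intro j
    simp [hM0]
    omega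
  · funext j
    have h : (a j) % (M : ℤ) = x j % (M : ℤ) := by
      apply Int.ModEq.symm
      rw [Int.modEq_iff_dvd]
      have := Int.dvd_self_sub_emod (x := q j - x j) (m := (M : ℤ))
      have e : a j - x j = q j - x j - (q j - x j) % (M : ℤ) := by
        simp only [a]; ring
      rw [e]; exact this
    change a j % (M : ℤ) = x j
    rw [h]
    exact Int.emod_eq_of_lt (hx j).1 (hx j).2
  · rw [mem_shift', mem_cube']
    intro j
    simp only [Pi.sub_apply, a, sub_sub_cancel]
    exact ⟨Int.emod_nonneg _ hM0.ne', Int.emod_lt_of_pos _ hM0⟩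

theorem one_residue {X : Type*} [NormedAddCommGroup X] {F : Finset (Zd d) → X}
    {b : Finset (Zd d) → ℝ} {D C : ℝ} (hb : IsBoundaryTerm b D) (hAA : AlmostAdditive F b)
    (hC : 0 < C) (hBd : Bounded F C) {M : ℕ} (hM : 1 ≤ M) (Q : Finset (Zd d)) (x : Zd d)
    (hx : x ∈ cube d M) :
    ‖F Q - ∑ a ∈ (goodS Q M).filter (fun a => res M a = x), F (shift a (cube d M))‖ ≤
      (((goodS Q M).filter (fun a => res M a = x)).card : ℝ) * b (cube d M)
        + (C + D) * (sBdry M Q).card := by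
  classical
  obtain ⟨hb0, hbs, -, hD, hbD⟩ := hb
  set I := (goodS Q M).filter (fun a => res M a = x) with hI
  set R := Q \ I.biUnion (fun a => shift a (cube d M)) with hR
  have hRc : (R.card : ℝ) ≤ (sBdry M Q).card := by
    norm_cast
    apply Finset.card_le_card
    intro q hq
    by_contra hqb
    rw [hR, Finset.mem_sdiff] at hq
    obtain ⟨a, ha, hax, hqa⟩ := cover hM Q x hx q hq.1 hqb
    exact hq.2 (Finset.mem_biUnion.2 ⟨a, by rw [hI, Finset.mem_filter]; exact ⟨ha, hax⟩, hqa⟩)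
  let f : Option (Zd d) → Finset (Zd d) := fun o => o.elim R (fun a => shift a (cube d M))
  have key := aa_finset hAA (Finset.insertNone I) f (by
    have hdisj : ∀ a ∈ I, Disjoint R (shift a (cube d M)) := by
      intro a ha
      rw [Finset.disjoint_left]
      intro z hz hz'
      rw [hR, Finset.mem_sdiff] at hz
      exact hz.2 (Finset.mem_biUnion.2 ⟨a, ha, hz'⟩)
    intro o ho p hp hne
    rcases o with _ | a <;> rcases p with _ | c
    · exact absurd rfl hne
    · exact hdisj c (by simpa using hp)
    · exact (hdisj a (by simpa using ho)).symm
    · have ha : a ∈ I := by simpa using ho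
      have hc : c ∈ I := by simpa using hp
      refine shift_disj a c ?_ (fun h => hne (by rw [h]))
      rw [(Finset.mem_filter.1 ha).2, (Finset.mem_filter.1 hc).2])
  have hU : (Finset.insertNone I).biUnion f = Q := by
    ext z
    rw [Finset.mem_biUnion]
    constructor
    · rintro ⟨o, ho, hz⟩
      rcases o with _ | a
      · exact (Finset.mem_sdiff.1 hz).1
      · have ha : a ∈ I := by simpa using ho
        exact (Finset.mem_filter.1 (Finset.mem_filter.1 ha).1).2 hz
    · intro hz
      by_cases h : z ∈ I.biUnion (fun a => shift a (cube d M))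
      · obtain ⟨a, ha, hza⟩ := Finset.mem_biUnion.1 h
        exact ⟨some a, by simpa using ha, hza⟩
      · exact ⟨none, by simp, Finset.mem_sdiff.2 ⟨hz, h⟩⟩
  rw [hU, Finset.sum_insertNone, Finset.sum_insertNone] at key
  simp only [f, Option.elim, hbs, Finset.sum_const, nsmul_eq_mul] at key
  have h1 := hBd R
  have h2 := hbD R
  have h3 : F Q - ∑ a ∈ I, F (shift a (cube d M)) =
      (F Q - (F R + ∑ a ∈ I, F (shift a (cube d M)))) + F R := by abel
  rw [h3]
  have h4 := norm_add_le (F Q - (F R + ∑ a ∈ I, F (shift a (cube d M)))) (F R)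
  have h5 : (C + D) * (R.card : ℝ) ≤ (C + D) * (sBdry M Q).card :=
    mul_le_mul_of_nonneg_left hRc (by positivity)
  linarith

theorem all_residues {X : Type*} [NormedAddCommGroup X] [NormedSpace ℝ X]
    {F : Finset (Zd d) → X}
    {b : Finset (Zd d) → ℝ} {D C : ℝ} (hb : IsBoundaryTerm b D) (hAA : AlmostAdditive F b)
    (hC : 0 < C) (hBd : Bounded F C) {M : ℕ} (hM : 1 ≤ M) (Q : Finset (Zd d)) :
    ‖((cube d M).card : ℝ) • F Q - ∑ a ∈ goodS Q M, F (shift a (cube d M))‖ ≤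
      (Q.card : ℝ) * b (cube d M) + (cube d M).card * ((C + D) * (sBdry M Q).card) := by
  have hsum : ∑ a ∈ goodS Q M, F (shift a (cube d M)) = ∑ x ∈ cube d M,
      ∑ a ∈ (goodS Q M).filter (fun a => res M a = x), F (shift a (cube d M)) :=
    (Finset.sum_fiberwise_of_maps_to (fun a _ => res_mem hM a) _).symm
  have hcard : (goodS Q M).card = ∑ x ∈ cube d M,
      ((goodS Q M).filter (fun a => res M a = x)).card :=
    Finset.card_eq_sum_card_fiberwise (fun a _ => res_mem hM a)
  have hle : ((goodS Q M).card : ℝ) ≤ Q.card := by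
    exact_mod_cast Finset.card_le_card (Finset.filter_subset _ _)
  have e : ((cube d M).card : ℝ) • F Q = ∑ x ∈ cube d M, F Q := by
    rw [Finset.sum_const, Nat.cast_smul_eq_nsmul]
  rw [hsum, e, ← Finset.sum_sub_distrib]
  refine (norm_sum_le_of_le _ (fun x hx => one_residue hb hAA hC hBd hM Q x hx)).trans ?_
  rw [Finset.sum_add_distrib, ← Finset.sum_mul, ← Nat.cast_sum, ← hcard, Finset.sum_const,
    nsmul_eq_mul]
  have := mul_le_mul_of_nonneg_right hle (hb.1 (cube d M))
  linarith

theorem cube_isBox {M : ℕ} (hM : 1 ≤ M) : IsBoxAtOrigin (cube d M) := by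
  refine ⟨fun _ => (M : ℤ) - 1, fun _ => by dsimp only; omega, ?_⟩
  ext y
  rw [mem_cube']
  simp only [Fintype.mem_piFinset, Finset.mem_Icc]
  refine forall_congr' fun j => ?_
  omega

theorem sum_patterns {X : Type*} [NormedAddCommGroup X] [NormedSpace ℝ X] [Fintype A]
    (Λ : Zd d → A) {F : Finset (Zd d) → X} {Ft : Finset (Zd d) → (Zd d → A) → X}
    (hFt : IsInducedMap Λ F Ft) {M : ℕ} (hM : 1 ≤ M) (Q : Finset (Zd d)) :
    ∑ a ∈ goodS Q M, F (shift a (cube d M)) = ∑ P : ↥(cube d M) → A,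
      (occ (cube d M) (extPat Λ (cube d M) P) Q Λ : ℝ) •
        Ft (cube d M) (extPat Λ (cube d M) P) := by
  classical
  rw [← Finset.sum_fiberwise (goodS Q M)
    (fun a => (fun y : ↥(cube d M) => Λ (a + y)))]
  refine Finset.sum_congr rfl fun P _ => ?_
  have hocc : occ (cube d M) (extPat Λ (cube d M) P) Q Λ =
      ((goodS Q M).filter (fun a => (fun y : ↥(cube d M) => Λ (a + y)) = P)).card := by
    unfold occ goodS
    rw [Finset.filter_filter]
    congr 1
    ext a
    simp only [Finset.mem_filter]
    refine and_congr_right fun _ => and_congr_right fun _ => ?_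
    constructor
    · intro h
      funext y
      have := h y y.2
      simpa [extPat] using this
    · rintro rfl y hy
      simp [extPat, hy]
  rw [hocc, Nat.cast_smul_eq_nsmul, ← Finset.sum_const]
  refine Finset.sum_congr rfl fun a ha => ?_
  rw [hFt.2 a _ (cube_isBox hM)]
  apply hFt.1
  intro y hy
  have := congrFun (Finset.mem_filter.1 ha).2 ⟨y, hy⟩
  simpa [extPat, hy] using this

/-- **Corollary (a priori bound for the pattern approximants):** under assumption (E), with
`F̄ = lim_j F(Q_j)/|Q_j|`, for all `M`:
`‖F̄ − Σ_{P∈𝓟_M} ν_P F̃(P)/|C_M|‖ ≤ b(C_M)/|C_M|`. -/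
theorem ergodic_patAvg_bound {X : Type*} [NormedAddCommGroup X] [NormedSpace ℝ X]
    [CompleteSpace X] [Fintype A]
    (hd : 1 ≤ d) (Λ : Zd d → A) (Qs : ℕ → Finset (Zd d)) (hvH : VanHove Qs)
    (ν : Finset (Zd d) → (Zd d → A) → ℝ) (hν : Freqs Λ Qs ν)
    (F : Finset (Zd d) → X) (b : Finset (Zd d) → ℝ) (D : ℝ) (hb : IsBoundaryTerm b D)
    (hInv : Invariant Λ F) (Ft : Finset (Zd d) → (Zd d → A) → X) (hFt : IsInducedMap Λ F Ft)
    (hAA : AlmostAdditive F b) (C : ℝ) (hCpos : 0 < C) (hBd : Bounded F C)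
    (Fbar : X)
    (hFbar : Filter.Tendsto (fun j => (((Qs j).card : ℝ))⁻¹ • F (Qs j))
      Filter.atTop (nhds Fbar)) :
    ∀ M : ℕ, 1 ≤ M →
      ‖Fbar - patAvg Λ ν Ft M‖ ≤ b (cube d M) / ((cube d M).card : ℝ) := by
  intro M hM
  have hcpos : (0 : ℝ) < (cube d M).card := by
    have : (cube d M).Nonempty := ⟨_, res_mem hM 0⟩
    exact_mod_cast this.card_pos
  have hT1 : Tendsto (fun j => (((Qs j).card : ℝ))⁻¹ • F (Qs j) -
      (((cube d M).card : ℝ))⁻¹ • ∑ P : ↥(cube d M) → A,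
        ((occ (cube d M) (extPat Λ (cube d M) P) (Qs j) Λ : ℝ) / ((Qs j).card : ℝ)) •
          Ft (cube d M) (extPat Λ (cube d M) P)) atTop (nhds (Fbar - patAvg Λ ν Ft M)) := by
    refine hFbar.sub (Tendsto.const_smul ?_ _)
    refine tendsto_finset_sum _ fun P _ => ?_
    exact (hν _ (cube_isBox hM) _).smul_const _
  have hT2 : Tendsto (fun j => b (cube d M) / ((cube d M).card : ℝ) +
      (C + D) * (((sBdry M (Qs j)).card : ℝ) / ((Qs j).card : ℝ))) atTop
      (nhds (b (cube d M) / ((cube d M).card : ℝ))) := by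
    have := ((hvH.2 M).const_mul (C + D)).const_add (b (cube d M) / ((cube d M).card : ℝ))
    simpa using this
  refine le_of_tendsto_of_tendsto' hT1.norm hT2 fun j => ?_
  have hq : (0 : ℝ) < (Qs j).card := by exact_mod_cast (hvH.1 j).card_pos
  have h := all_residues hb hAA hCpos hBd hM (Qs j)
  rw [sum_patterns Λ hFt hM] at h
  set c : ℝ := ((cube d M).card : ℝ)
  set q : ℝ := ((Qs j).card : ℝ)
  have e : q⁻¹ • F (Qs j) - c⁻¹ • ∑ P : ↥(cube d M) → A,
        ((occ (cube d M) (extPat Λ (cube d M) P) (Qs j) Λ : ℝ) / q) •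
          Ft (cube d M) (extPat Λ (cube d M) P) =
      (c * q)⁻¹ • (c • F (Qs j) - ∑ P : ↥(cube d M) → A,
        (occ (cube d M) (extPat Λ (cube d M) P) (Qs j) Λ : ℝ) •
          Ft (cube d M) (extPat Λ (cube d M) P)) := by
    rw [smul_sub, smul_smul, Finset.smul_sum, Finset.smul_sum]
    congr 1
    · congr 1
      field_simp
    · refine Finset.sum_congr rfl fun P _ => ?_
      rw [smul_smul, smul_smul]
      congr 1
      field_simp
  rw [e, norm_smul, Real.norm_of_nonneg (by positivity)]
  calc _ ≤ (c * q)⁻¹ * (q * b (cube d M) + c * ((C + D) * (sBdry M (Qs j)).card)) :=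
        mul_le_mul_of_nonneg_left h (by positivity)
    _ = _ := by field_simp

end IDSZd
end
end
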